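/- Let m ≥ 3 be an odd integer, ω = e^{2πi/m}, and l = (m+1)/2. Let A be a unital associative ℂ-algebra and suppose U, Z ∈ A satisfy U^m = 1 and U·Z = ω^{-1}·(Z·U). Set R = (1/√m)·Σ_{j=0}^{m-1} ω^{j²}·U^j. Then R·Z = ω^{-l²}·Z·U^l·R. -/

import Mathlib

open Finset

/-- The Gaussian element `g(U) = (1/√m)·Σ_{j=0}^{m-1} ω^{j²}·U^j` in a unital
associative `ℂ`-algebra. -/
noncomputable def gauss {A : Type*} [Ring A] [Algebra ℂ A] (m : ℕ) (ω : ℂ)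
    (U : A) : A :=
  ((1 / Real.sqrt m : ℝ) : ℂ) • ∑ j ∈ Finset.range m, ω ^ (j ^ 2) • U ^ j

/-- The sum of an `m`-periodic function over `m` consecutive naturals does not depend on the
starting point. -/
theorem Function.Periodic.sum_range_add {M : Type*} [AddCommGroup M] {f : ℕ → M} {m : ℕ}
    (hf : Function.Periodic f m) (l : ℕ) :
    ∑ k ∈ Finset.range m, f (k + l) = ∑ k ∈ Finset.range m, f k := by
  induction l with
  | zero => rfl
  | succ l ih =>
    have h := Finset.sum_range_succ' (fun k => f (k + l)) m
    rw [Finset.sum_range_succ, ih, add_comm m l, hf l, Nat.zero_add] at h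
    rw [add_right_cancel h]
    exact Finset.sum_congr rfl fun k _ => congrArg f (by omega)

/-- Powers of `U` commute past `Z` up to powers of `q` when `U` and `Z` `q`-commute. -/
theorem pow_mul_eq_smul_mul_pow {K A : Type*} [CommRing K] [Ring A] [Algebra K A] {q : K}
    {U Z : A} (h : U * Z = q • (Z * U)) (j : ℕ) : U ^ j * Z = q ^ j • (Z * U ^ j) := by
  induction j with
  | zero => simp
  | succ j ih =>
    rw [pow_succ, mul_assoc, h, mul_smul_comm, ← mul_assoc, ih, smul_mul_assoc, smul_smul,
      mul_assoc, pow_succ' q]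

/-- For `U^m = 1`, `U·Z = ω^{-1}·(Z·U)`, `ω = e^{2πi/m}`, `m ≥ 3` odd, and
`l = (m+1)/2`, the localizing `R`-matrix `R = g(U)` satisfies
`R·Z = ω^{-l²}·Z·U^l·R`. -/
theorem gauss_R_conjugates_Z (m : ℕ) (hm : 3 ≤ m) (hodd : Odd m)
    {A : Type*} [Ring A] [Algebra ℂ A]
    (ω : ℂ) (hω : ω = Complex.exp (2 * (Real.pi : ℂ) * Complex.I / (m : ℂ)))
    (l : ℕ) (hl : l = (m + 1) / 2)
    (U Z : A) (hU : U ^ m = 1)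
    (hUZ : U * Z = ω⁻¹ • (Z * U)) :
    gauss m ω U * Z
      = (ω ^ (-((l : ℤ)) ^ 2)) • (Z * (U ^ l * gauss m ω U)) := by
  have hroot : ω ^ m = 1 := by
    rw [hω]
    exact (Complex.isPrimitiveRoot_exp m (by omega)).pow_eq_one
  have hω0 : ω ≠ 0 := hω ▸ Complex.exp_ne_zero _
  have h2l : 2 * l = m + 1 := by
    obtain ⟨k, rfl⟩ := hodd
    omega
  have hper : Function.Periodic (fun j : ℕ => (ω ^ j ^ 2 * ω⁻¹ ^ j) • U ^ j) m := fun j => by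
    have hsq : (j + m) ^ 2 = j ^ 2 + m * (2 * j + m) := by ring
    simp only [hsq, pow_add, pow_mul, inv_pow, hroot, hU, one_pow, inv_one, mul_one]
  have hcoeff (k : ℕ) :
      ω ^ (k + l) ^ 2 * ω⁻¹ ^ (k + l) = ω ^ (-((l : ℤ)) ^ 2) * ω ^ k ^ 2 := by
    have hexp : (k + l) ^ 2 + l ^ 2 = k ^ 2 + (k + l) + m * (k + l) := by
      linear_combination (k + l) * h2l
    have hpow : ω ^ (k + l) ^ 2 * ω ^ l ^ 2 = ω ^ k ^ 2 * ω ^ (k + l) := by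
      rw [← pow_add, hexp, pow_add _ _ (m * _), pow_mul, hroot, one_pow, mul_one, pow_add]
    have hz : ω ^ (-((l : ℤ)) ^ 2) = (ω ^ l ^ 2)⁻¹ := by
      rw [zpow_neg]
      norm_cast
    rw [hz, inv_pow, ← div_eq_mul_inv, ← div_eq_inv_mul,
      div_eq_div_iff (pow_ne_zero _ hω0) (pow_ne_zero _ hω0), hpow]
  calc gauss m ω U * Z
      = ((1 / Real.sqrt m : ℝ) : ℂ) •
          (Z * ∑ j ∈ Finset.range m, (ω ^ j ^ 2 * ω⁻¹ ^ j) • U ^ j) := by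
        simp only [gauss, smul_mul_assoc, Finset.sum_mul, Finset.mul_sum, mul_smul_comm,
          pow_mul_eq_smul_mul_pow hUZ, smul_smul]
    _ = ((1 / Real.sqrt m : ℝ) : ℂ) • (Z * ∑ k ∈ Finset.range m,
          (ω ^ (-((l : ℤ)) ^ 2) * ω ^ k ^ 2) • (U ^ l * U ^ k)) := by
        rw [← hper.sum_range_add l]
        simp only [hcoeff, ← pow_add, add_comm l]
    _ = (ω ^ (-((l : ℤ)) ^ 2)) • (Z * (U ^ l * gauss m ω U)) := by
        simp only [gauss, mul_smul_comm, mul_smul, ← Finset.smul_sum]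
        rw [smul_comm]
        simp only [Finset.mul_sum, mul_smul_comm]
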